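/- Let k be a real number with |k| < 2. Then for every complex number s with Re(s) > −1, W₁(k;s) = (4^s · Γ((1+s)/2)² / (π · Γ(1+s))) · ₂F₁(−s/2, −s/2; 1/2; k²/4), where the hypergeometric series converges since k²/4 < 1. -/

import Mathlib

open MeasureTheory Real

/-- `t ^ s` for real `t ≥ 0` and complex `s`, with `0 ^ s := 0`. -/
noncomputable def cpow0 (t : ℝ) (s : ℂ) : ℂ :=
  if t = 0 then 0 else Complex.exp (s * Real.log t)

/-- Pochhammer symbol `(x)ₙ = x (x+1) ⋯ (x+n-1)` in `ℂ`. -/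
noncomputable def poch (x : ℂ) (n : ℕ) : ℂ := (ascPochhammer ℂ n).eval x

/-- The zeta Mahler function `W₁(k;s) = (2π)⁻¹ ∫₀^{2π} |k + 2 cos θ|^s dθ`. -/
noncomputable def W1 (k : ℝ) (s : ℂ) : ℂ :=
  ((2 * π : ℝ) : ℂ)⁻¹ * ∫ θ in (0:ℝ)..(2 * π), cpow0 |k + 2 * Real.cos θ| s

/-- The `n`-th coefficient of the hypergeometric series `₂F₁(a, b; c; z)`. -/
noncomputable def hypCoeff (a b c : ℂ) (n : ℕ) : ℂ :=
  poch a n * poch b n / (poch c n * (n.factorial : ℂ))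

lemma poch_zero (x : ℂ) : poch x 0 = 1 := by simp [poch]

lemma poch_succ (x : ℂ) (n : ℕ) : poch x (n + 1) = poch x n * (x + n) := by
  simp [poch, ascPochhammer_succ_eval]

lemma poch_ne_zero {x : ℂ} (hx : ∀ n : ℕ, x + n ≠ 0) (n : ℕ) : poch x n ≠ 0 := by
  induction n with
  | zero => simp [poch_zero]
  | succ n ih => rw [poch_succ]; exact mul_ne_zero ih (hx n)

lemma add_natCast_ne_zero_of_re_pos {x : ℂ} (hx : 0 < x.re) (n : ℕ) : x + n ≠ 0 := by
  intro h
  have := congrArg Complex.re h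
  simp at this
  have : (0 : ℝ) ≤ n := n.cast_nonneg
  linarith

lemma hypCoeff_zero (a b c : ℂ) : hypCoeff a b c 0 = 1 := by simp [hypCoeff, poch_zero]

lemma hypCoeff_succ {c : ℂ} (hc : ∀ n : ℕ, c + n ≠ 0) (a b : ℂ) (n : ℕ) :
    ((n : ℂ) + 1) * (c + n) * hypCoeff a b c (n + 1) = (a + n) * (b + n) * hypCoeff a b c n := by
  have h1 := poch_ne_zero hc n
  have h2 := hc n
  have h3 : (n.factorial : ℂ) ≠ 0 := by exact_mod_cast n.factorial_ne_zero
  have h4 : (n : ℂ) + 1 ≠ 0 := by exact_mod_cast n.succ_ne_zero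
  simp only [hypCoeff, poch_succ, Nat.factorial_succ, Nat.cast_mul, Nat.cast_add, Nat.cast_one]
  field_simp

lemma eq_hypCoeff_of_recurrence {c : ℂ} (hc : ∀ n : ℕ, c + n ≠ 0) {a b : ℂ} {u : ℕ → ℂ}
    (h0 : u 0 = 1)
    (h : ∀ n : ℕ, ((n : ℂ) + 1) * (c + n) * u (n + 1) = (a + n) * (b + n) * u n) (n : ℕ) :
    u n = hypCoeff a b c n := by
  induction n with
  | zero => rw [h0, hypCoeff_zero]
  | succ n ih =>
    have h4 : (n : ℂ) + 1 ≠ 0 := by exact_mod_cast n.succ_ne_zero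
    refine mul_left_cancel₀ (mul_ne_zero h4 (hc n)) ?_
    rw [h, hypCoeff_succ hc, ih]

open PowerSeries in
/-- Hypergeometric recurrences on coefficients amount to the hypergeometric differential
equation. -/
lemma hypergeometric_ode_iff (a b c : ℂ) (F : PowerSeries ℂ) :
    (X * (1 - X) * d⁄dX ℂ (d⁄dX ℂ F) + (C c - C (a + b + 1) * X) * d⁄dX ℂ F - C (a * b) * F = 0) ↔
      ∀ n : ℕ, ((n : ℂ) + 1) * (c + n) * coeff (n + 1) F = (a + n) * (b + n) * coeff n F := by
  have key : ∀ n : ℕ, coeff n (X * (1 - X) * d⁄dX ℂ (d⁄dX ℂ F) +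
      (C c - C (a + b + 1) * X) * d⁄dX ℂ F - C (a * b) * F) =
      ((n : ℂ) + 1) * (c + n) * coeff (n + 1) F - (a + n) * (b + n) * coeff n F := by
    intro n
    have e : X * (1 - X) * d⁄dX ℂ (d⁄dX ℂ F) + (C c - C (a + b + 1) * X) * d⁄dX ℂ F
        - C (a * b) * F = X * d⁄dX ℂ (d⁄dX ℂ F) - X * (X * d⁄dX ℂ (d⁄dX ℂ F)) +
        C c * d⁄dX ℂ F - C (a + b + 1) * (X * d⁄dX ℂ F) - C (a * b) * F := by ring
    rw [e]
    generalize hd : a + b + 1 = d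
    rcases n with _ | _ | n <;>
      simp only [map_sub, map_add, coeff_zero_X_mul, coeff_succ_X_mul, coeff_derivative,
        coeff_C_mul, Nat.cast_zero, Nat.cast_add, Nat.cast_one] <;> subst hd <;> ring
  constructor
  · intro h n
    have := key n
    rw [h] at this
    simp only [map_zero] at this
    linear_combination -this
  · intro h
    ext n
    rw [key, h]
    simp

open PowerSeries in
/-- Coefficientwise form of Euler's transformation
`₂F₁(a, b; c; z) = (1 - z) ^ (c - a - b) ₂F₁(c - a, c - b; c; z)`. -/
lemma euler_transformation_coeff {c : ℂ} (hc : ∀ n : ℕ, c + n ≠ 0) (a b : ℂ) (n : ℕ) :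
    ∑ ij ∈ Finset.HasAntidiagonal.antidiagonal n, (poch (a + b - c) ij.1 / (ij.1.factorial : ℂ)) *
      hypCoeff (c - a) (c - b) c ij.2 = hypCoeff a b c n := by
  set p := a + b - c with hp
  let Q : PowerSeries ℂ := PowerSeries.mk fun n => poch p n / (n.factorial : ℂ)
  let G : PowerSeries ℂ := PowerSeries.mk (hypCoeff (c - a) (c - b) c)
  have hQ : (1 - X) * d⁄dX ℂ Q = C p * Q := by
    ext n
    have h3 : (n.factorial : ℂ) ≠ 0 := by exact_mod_cast n.factorial_ne_zero
    have h4 : (n : ℂ) + 1 ≠ 0 := by exact_mod_cast n.succ_ne_zero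
    rw [sub_mul, one_mul]
    rcases n with _ | n
    · simp only [Q, map_sub, coeff_derivative, coeff_zero_X_mul, coeff_mk, coeff_C_mul, poch_succ,
        poch_zero]
      simp
    · have h5 : (n : ℂ) + 1 + 1 ≠ 0 := by exact_mod_cast h4
      have h6 : (n.factorial : ℂ) ≠ 0 := by exact_mod_cast n.factorial_ne_zero
      have h7 : (n : ℂ) + 1 ≠ 0 := by exact_mod_cast n.succ_ne_zero
      simp only [Q, map_sub, coeff_derivative, coeff_succ_X_mul, coeff_mk, coeff_C_mul, poch_succ,
        Nat.factorial_succ, Nat.cast_mul, Nat.cast_add, Nat.cast_one]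
      field_simp
      ring
  have hG := (hypergeometric_ode_iff (c - a) (c - b) c G).2 fun n => by
    simpa [G] using hypCoeff_succ hc (c - a) (c - b) n
  have hX : (1 - X : PowerSeries ℂ) ≠ 0 := by
    intro h
    have := congrArg (coeff 0) h
    simp at this
  have hH : X * (1 - X) * d⁄dX ℂ (d⁄dX ℂ (Q * G)) +
      (C c - C (a + b + 1) * X) * d⁄dX ℂ (Q * G) - C (a * b) * (Q * G) = 0 := by
    refine (mul_eq_zero.1 (?_ : (1 - X : PowerSeries ℂ) * _ = 0)).resolve_left hX
    have hQ2 := congrArg (d⁄dX ℂ) hQ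
    simp only [Derivation.leibniz, smul_eq_mul, map_add, map_sub, map_mul, derivative_C,
      derivative_X, Derivation.map_one_eq_zero] at hQ2 hQ hG ⊢
    simp only [hp, map_sub, map_add, map_one] at hQ2 hQ hG ⊢
    generalize d⁄dX ℂ (d⁄dX ℂ Q) = Q2 at *
    generalize d⁄dX ℂ (d⁄dX ℂ G) = G2 at *
    generalize d⁄dX ℂ Q = Q1 at *
    generalize d⁄dX ℂ G = G1 at *
    linear_combination X * (1 - X) * G * hQ2 + (X * (1 + (C a + C b - C c)) * G +
      2 * X * (1 - X) * G1 + (C c - (C a + C b + 1) * X) * G) * hQ + Q * (1 - X) * hG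
  have := eq_hypCoeff_of_recurrence hc (u := fun n => coeff n (Q * G)) (by
    simp [Q, G, poch_zero, hypCoeff_zero, coeff_mul])
    ((hypergeometric_ode_iff a b c _).1 hH) n
  simpa [coeff_mul, Q, G] using this

lemma hasSum_poch_mul_pow (a : ℂ) {y : ℂ} (hy : ‖y‖ < 1) :
    HasSum (fun n => poch a n / (n.factorial : ℂ) * y ^ n) ((1 - y) ^ (-a)) ∧
      Summable fun n => ‖poch a n / (n.factorial : ℂ) * y ^ n‖ := by
  have h := Complex.one_div_one_sub_cpow_hasFPowerSeriesOnBall_zero a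
  have hmem : y ∈ Metric.eball (0 : ℂ) 1 := by
    rw [mem_eball_zero_iff, ← ofReal_norm, ENNReal.ofReal_lt_one]
    exact hy
  have hterm : ∀ n : ℕ, (FormalMultilinearSeries.ofScalars ℂ
      (fun n : ℕ => Ring.choose (a + n - 1) n) n fun _ => y) =
      poch a n / (n.factorial : ℂ) * y ^ n := by
    intro n
    have h3 : (n.factorial : ℂ) ≠ 0 := by exact_mod_cast n.factorial_ne_zero
    have h1 := Ring.factorial_nsmul_multichoose_eq_ascPochhammer a n
    rw [Polynomial.ascPochhammer_smeval_eq_eval, Ring.multichoose_eq, nsmul_eq_mul] at h1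
    rw [FormalMultilinearSeries.ofScalars_apply_eq, smul_eq_mul, poch, ← h1]
    field_simp
  constructor
  · have := h.hasSum hmem
    simp only [hterm, zero_add] at this
    rwa [Complex.cpow_neg, ← one_div]
  · have := FormalMultilinearSeries.summable_norm_apply _ (Metric.eball_subset_eball h.r_le hmem)
    simpa only [hterm] using this

lemma hasSum_even_poch_mul_pow (a : ℂ) {y : ℂ} (hy : ‖y‖ < 1) :
    HasSum (fun m : ℕ => 2 * (poch a (2 * m) / ((2 * m).factorial : ℂ) * y ^ (2 * m)))
      ((1 - y) ^ (-a) + (1 + y) ^ (-a)) := by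
  have h1 := (hasSum_poch_mul_pow a hy).1
  have h2 := (hasSum_poch_mul_pow a (y := -y) (by simpa using hy)).1
  rw [sub_neg_eq_add] at h2
  have h3 := h1.add h2
  have hinj : Function.Injective fun m : ℕ => 2 * m := fun i j hij => by
    simpa using hij
  rw [← hinj.hasSum_iff] at h3
  · convert h3 using 2 with m
    simp [pow_mul]
    ring
  · intro n hn
    have : Odd n := by
      rw [← Nat.not_even_iff_odd]
      rintro ⟨m, rfl⟩
      exact hn ⟨m, by simp [two_mul]⟩
    simp [this.neg_pow]

lemma summable_norm_hypCoeff_mul_pow {a b c : ℂ} (ha : ∀ n : ℕ, a + n ≠ 0)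
    (hb : ∀ n : ℕ, b + n ≠ 0) (hc : ∀ n : ℕ, c + n ≠ 0) {z : ℂ} (hz : ‖z‖ < 1) :
    Summable fun n => ‖hypCoeff a b c n * z ^ n‖ := by
  have hr := ordinaryHypergeometricSeries_radius_eq_one (𝕂 := ℂ) ℂ a b c fun n => by
    refine ⟨fun h => ha n ?_, fun h => hb n ?_, fun h => hc n ?_⟩ <;> rw [h] <;> ring
  have hmem : z ∈ Metric.eball (0 : ℂ) (ordinaryHypergeometricSeries ℂ a b c).radius := by
    rw [hr, mem_eball_zero_iff, ← ofReal_norm, ENNReal.ofReal_lt_one]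
    exact hz
  refine (FormalMultilinearSeries.summable_norm_apply _ hmem).congr fun n => ?_
  rw [ordinaryHypergeometricSeries_apply_eq, smul_eq_mul, hypCoeff, poch, poch, poch]
  simp only [div_eq_mul_inv, mul_inv]
  ring_nf

/-- **Euler's transformation** of the hypergeometric series. -/
lemma tsum_hypCoeff_euler {a b c : ℂ} (ha : ∀ n : ℕ, c - a + n ≠ 0) (hb : ∀ n : ℕ, c - b + n ≠ 0)
    (hc : ∀ n : ℕ, c + n ≠ 0) {z : ℂ} (hz : ‖z‖ < 1) :
    ∑' n, hypCoeff a b c n * z ^ n =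
      (1 - z) ^ (c - a - b) * ∑' n, hypCoeff (c - a) (c - b) c n * z ^ n := by
  have h := hasSum_poch_mul_pow (a + b - c) hz
  have he : c - a - b = -(a + b - c) := by ring
  rw [he, ← h.1.tsum_eq, tsum_mul_tsum_eq_tsum_sum_antidiagonal_of_summable_norm h.2
    (summable_norm_hypCoeff_mul_pow ha hb hc hz)]
  refine tsum_congr fun n => ?_
  rw [← euler_transformation_coeff hc, Finset.sum_mul]
  refine Finset.sum_congr rfl fun ij hij => ?_
  rw [← Finset.HasAntidiagonal.mem_antidiagonal.1 hij, pow_add]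
  ring

lemma image_cos_sq : (fun w => Real.cos w ^ 2) '' Set.Ioo 0 (π / 2) = Set.Ioo 0 1 := by
  ext x
  constructor
  · rintro ⟨w, ⟨h0, h1⟩, rfl⟩
    have hc := Real.cos_pos_of_mem_Ioo ⟨by linarith [pi_pos], h1⟩
    have hs := Real.sin_pos_of_pos_of_lt_pi h0 (by linarith [pi_pos])
    have := Real.sin_sq_add_cos_sq w
    exact ⟨by positivity, by nlinarith⟩
  · rintro ⟨h0, h1⟩
    refine ⟨Real.arccos (√x), ⟨?_, ?_⟩, ?_⟩
    · rw [Real.arccos_pos, Real.sqrt_lt' one_pos]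
      simpa using h1
    · rw [Real.arccos_lt_pi_div_two]
      exact Real.sqrt_pos.2 h0
    · have h2 : √x ≤ 1 := Real.sqrt_le_one.2 h1.le
      simp only
      rw [Real.cos_arccos (by linarith [Real.sqrt_nonneg x]) h2, Real.sq_sqrt h0.le]

lemma injOn_cos_sq : Set.InjOn (fun w => Real.cos w ^ 2) (Set.Ioo 0 (π / 2)) := by
  intro x hx y hy h
  have hcx := Real.cos_pos_of_mem_Ioo (x := x) ⟨by linarith [pi_pos, hx.1], hx.2⟩
  have hcy := Real.cos_pos_of_mem_Ioo (x := y) ⟨by linarith [pi_pos, hy.1], hy.2⟩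
  have h' : Real.cos x = Real.cos y := by
    simpa [abs_of_pos hcx, abs_of_pos hcy] using sq_eq_sq_iff_abs_eq_abs _ _ |>.1 h
  exact Real.injOn_cos ⟨hx.1.le, by linarith [pi_pos, hx.2]⟩ ⟨hy.1.le, by linarith [pi_pos, hy.2]⟩ h'

lemma integral_cos_cpow {u : ℂ} (hu : 0 < u.re) :
    IntegrableOn (fun w : ℝ => (Real.cos w : ℂ) ^ (2 * u - 1)) (Set.Ioo 0 (π / 2)) ∧
      2 * ∫ w in Set.Ioo 0 (π / 2), (Real.cos w : ℂ) ^ (2 * u - 1) =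
        Complex.betaIntegral u (1 / 2) := by
  have hv : (0 : ℝ) < (1 / 2 : ℂ).re := by norm_num
  let g : ℝ → ℂ := fun x => (x : ℂ) ^ (u - 1) * (1 - (x : ℂ)) ^ ((1 / 2 : ℂ) - 1)
  have hd : ∀ w ∈ Set.Ioo 0 (π / 2), HasDerivWithinAt (fun w => Real.cos w ^ 2)
      (2 * Real.cos w * -Real.sin w) (Set.Ioo 0 (π / 2)) w := by
    intro w _
    exact (((Real.hasDerivAt_cos w).fun_pow 2).congr_deriv (by simp)).hasDerivWithinAt
  have hg : ∀ w ∈ Set.Ioo 0 (π / 2), |2 * Real.cos w * -Real.sin w| • g (Real.cos w ^ 2) =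
      2 * (Real.cos w : ℂ) ^ (2 * u - 1) := by
    rintro w ⟨h0, h1⟩
    have hc := Real.cos_pos_of_mem_Ioo (x := w) ⟨by linarith [pi_pos], h1⟩
    have hs := Real.sin_pos_of_pos_of_lt_pi h0 (by linarith [pi_pos])
    have hc' : (Real.cos w : ℂ) ≠ 0 := by exact_mod_cast hc.ne'
    have hs' : (Real.sin w : ℂ) ≠ 0 := by exact_mod_cast hs.ne'
    have e1 : |2 * Real.cos w * -Real.sin w| = 2 * Real.cos w * Real.sin w := by
      rw [mul_neg, abs_neg, abs_of_pos (by positivity)]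
    have e2 : ((Real.cos w ^ 2 : ℝ) : ℂ) ^ (u - 1) = (Real.cos w : ℂ) ^ (2 * u - 2) := by
      rw [pow_two, Complex.ofReal_mul, Complex.mul_cpow_ofReal_nonneg hc.le hc.le,
        ← Complex.cpow_add _ _ hc']
      congr 1; ring_nf
    have e3 : (1 - ((Real.cos w ^ 2 : ℝ) : ℂ)) ^ ((1 / 2 : ℂ) - 1) = (Real.sin w : ℂ)⁻¹ := by
      have : (1 - ((Real.cos w ^ 2 : ℝ) : ℂ)) = (Real.sin w * Real.sin w : ℂ) := by
        rw [← Complex.ofReal_one, ← Complex.ofReal_sub, ← Complex.ofReal_mul]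
        congr 1
        linarith [Real.sin_sq_add_cos_sq w, pow_two (Real.sin w)]
      rw [this, Complex.mul_cpow_ofReal_nonneg hs.le hs.le, ← Complex.cpow_add _ _ hs',
        ← Complex.cpow_neg_one]
      norm_num
    have e4 : (Real.cos w : ℂ) ^ (2 * u - 1) =
        (Real.cos w : ℂ) ^ (2 * u - 2) * Real.cos w := by
      rw [show 2 * u - 1 = (2 * u - 2) + 1 by ring, Complex.cpow_add _ _ hc', Complex.cpow_one]
    simp only [g]
    rw [e1, e2, e3, e4, Complex.real_smul]
    push_cast
    rw [← Complex.ofReal_cos, ← Complex.ofReal_sin]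
    field_simp
  have hint := Complex.betaIntegral_convergent hu hv
  rw [intervalIntegrable_iff_integrableOn_Ioo_of_le zero_le_one] at hint
  constructor
  · change IntegrableOn g _ at hint
    rw [← image_cos_sq, integrableOn_image_iff_integrableOn_abs_deriv_smul measurableSet_Ioo hd
      injOn_cos_sq] at hint
    have h2 := (hint.congr_fun hg measurableSet_Ioo).const_mul (1 / 2)
    refine h2.congr (ae_of_all _ fun w => ?_)
    simp
  · rw [Complex.betaIntegral, intervalIntegral.integral_of_le zero_le_one,
      integral_Ioc_eq_integral_Ioo]
    change _ = ∫ x in Set.Ioo 0 1, g x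
    rw [← image_cos_sq, integral_image_eq_integral_abs_deriv_smul measurableSet_Ioo hd
      injOn_cos_sq, ← integral_const_mul]
    exact (setIntegral_congr_fun measurableSet_Ioo hg).symm

lemma integral_Ioo_two_mul {f : ℝ → ℂ} {a : ℝ} (ha : 0 < a) (h1 : IntegrableOn f (Set.Ioo 0 a))
    (h2 : IntegrableOn (fun x => f (2 * a - x)) (Set.Ioo 0 a)) :
    IntegrableOn f (Set.Ioo 0 (2 * a)) ∧
      ∫ x in Set.Ioo 0 (2 * a), f x = ∫ x in Set.Ioo 0 a, (f x + f (2 * a - x)) := by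
  have h3 := integral_add h1 h2
  rw [← intervalIntegrable_iff_integrableOn_Ioo_of_le ha.le] at h1 h2
  have h4 : IntervalIntegrable f volume a (2 * a) := by
    have := (h2.comp_sub_left (2 * a)).symm
    simpa [two_mul] using this
  refine ⟨(intervalIntegrable_iff_integrableOn_Ioo_of_le (by linarith)).1 (h1.trans h4), ?_⟩
  rw [h3, ← integral_Ioc_eq_integral_Ioo, ← integral_Ioc_eq_integral_Ioo,
    ← integral_Ioc_eq_integral_Ioo, ← intervalIntegral.integral_of_le ha.le,
    ← intervalIntegral.integral_of_le ha.le, ← intervalIntegral.integral_of_le (by linarith),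
    intervalIntegral.integral_comp_sub_left, ← intervalIntegral.integral_add_adjacent_intervals h1 h4]
  congr 2 <;> ring_nf

section Anomaly

variable {c : ℝ}

lemma one_sub_mul_cos_pos (hc : |c| < 1) (w : ℝ) : 0 < 1 - c * Real.cos w := by
  have h : |c * Real.cos w| < 1 := by
    rw [abs_mul]
    exact (mul_le_of_le_one_right (abs_nonneg _) (Real.abs_cos_le_one w)).trans_lt hc
  linarith [(abs_lt.1 h).2]

/-- The cosine of the angle `θ` with `c + cos θ = (1 - c²) cos w / (1 - c cos w)`. -/
noncomputable def mobiusCos (c w : ℝ) : ℝ := (Real.cos w - c) / (1 - c * Real.cos w)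

lemma one_sub_mobiusCos_sq (hc : |c| < 1) (w : ℝ) :
    1 - mobiusCos c w ^ 2 = (1 - c ^ 2) * (Real.sin w / (1 - c * Real.cos w)) ^ 2 := by
  have h := (one_sub_mul_cos_pos hc w).ne'
  rw [mobiusCos, div_pow, div_pow, Real.sin_sq, one_sub_div (pow_ne_zero 2 h), mul_div_assoc']
  congr 1
  ring

lemma one_sub_sq_pos_of_abs_lt_one (hc : |c| < 1) : 0 < 1 - c ^ 2 := by
  have := (sq_lt_one_iff_abs_lt_one c).2 hc
  linarith

lemma abs_mobiusCos_lt_one (hc : |c| < 1) {w : ℝ} (hw : w ∈ Set.Ioo 0 π) :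
    |mobiusCos c w| < 1 := by
  rw [← sq_lt_one_iff_abs_lt_one]
  have h1 := one_sub_mobiusCos_sq hc w
  have h2 := one_sub_sq_pos_of_abs_lt_one hc
  have h3 := one_sub_mul_cos_pos hc w
  have h4 := Real.sin_pos_of_pos_of_lt_pi hw.1 hw.2
  have : 0 < (1 - c ^ 2) * (Real.sin w / (1 - c * Real.cos w)) ^ 2 := by positivity
  linarith

lemma hasDerivAt_arccos_mobiusCos (hc : |c| < 1) {w : ℝ} (hw : w ∈ Set.Ioo 0 π) :
    HasDerivAt (fun w => Real.arccos (mobiusCos c w)) (√(1 - c ^ 2) / (1 - c * Real.cos w)) w := by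
  have h2 := one_sub_sq_pos_of_abs_lt_one hc
  have h3 := one_sub_mul_cos_pos hc w
  have h4 := Real.sin_pos_of_pos_of_lt_pi hw.1 hw.2
  have h5 := abs_lt.1 (abs_mobiusCos_lt_one hc hw)
  have hd : HasDerivAt (mobiusCos c) ((-Real.sin w * (1 - c * Real.cos w) -
      (Real.cos w - c) * (-(c * -Real.sin w))) / (1 - c * Real.cos w) ^ 2) w :=
    ((Real.hasDerivAt_cos w).sub_const c).div
      (((Real.hasDerivAt_cos w).const_mul c).const_sub 1) h3.ne'
  have := (Real.hasDerivAt_arccos h5.1.ne' h5.2.ne).comp w hd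
  have h6 := Real.sqrt_pos.2 h2
  refine this.congr_deriv ?_
  rw [one_sub_mobiusCos_sq hc, Real.sqrt_mul h2.le, Real.sqrt_sq (by positivity)]
  field_simp
  rw [Real.sq_sqrt h2.le]
  ring

lemma mobiusCos_neg_of_cos_eq (hc : |c| < 1) {w θ : ℝ} (h : Real.cos w = mobiusCos (-c) θ) :
    mobiusCos c w = Real.cos θ := by
  have h1 := one_sub_mul_cos_pos hc w
  have h2 := one_sub_mul_cos_pos (c := -c) (by simpa using hc) θ
  rw [mobiusCos, div_eq_iff h1.ne']
  rw [mobiusCos, eq_div_iff h2.ne'] at h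
  linarith

lemma image_arccos_mobiusCos (hc : |c| < 1) :
    (fun w => Real.arccos (mobiusCos c w)) '' Set.Ioo 0 π = Set.Ioo 0 π := by
  have key : ∀ {d : ℝ}, |d| < 1 → ∀ w ∈ Set.Ioo 0 π, Real.arccos (mobiusCos d w) ∈ Set.Ioo 0 π := by
    intro d hd w hw
    have h5 := abs_lt.1 (abs_mobiusCos_lt_one hd hw)
    refine ⟨Real.arccos_pos.2 h5.2, (Real.arccos_le_pi _).lt_of_ne fun h => ?_⟩
    rw [Real.arccos_eq_pi] at h
    linarith
  apply Set.Subset.antisymm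
  · rintro _ ⟨w, hw, rfl⟩
    exact key hc w hw
  · intro θ hθ
    have hc' : |-c| < 1 := by simpa using hc
    refine ⟨_, key hc' θ hθ, ?_⟩
    have h5 := abs_lt.1 (abs_mobiusCos_lt_one hc' hθ)
    simp only
    rw [mobiusCos_neg_of_cos_eq hc (Real.cos_arccos h5.1.le h5.2.le),
      Real.arccos_cos hθ.1.le hθ.2.le]

lemma injOn_arccos_mobiusCos (hc : |c| < 1) :
    Set.InjOn (fun w => Real.arccos (mobiusCos c w)) (Set.Ioo 0 π) := by
  intro x hx y hy h
  have hx5 := abs_lt.1 (abs_mobiusCos_lt_one hc hx)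
  have hy5 := abs_lt.1 (abs_mobiusCos_lt_one hc hy)
  have h' := Real.arccos_injOn ⟨hx5.1.le, hx5.2.le⟩ ⟨hy5.1.le, hy5.2.le⟩ h
  have h1 := one_sub_mul_cos_pos hc x
  have h2 := one_sub_mul_cos_pos hc y
  have h3 := one_sub_sq_pos_of_abs_lt_one hc
  rw [mobiusCos, mobiusCos, div_eq_div_iff h1.ne' h2.ne'] at h'
  have h4 : Real.cos x = Real.cos y :=
    mul_left_cancel₀ h3.ne' (by linarith)
  exact Real.injOn_cos ⟨hx.1.le, hx.2.le⟩ ⟨hy.1.le, hy.2.le⟩ h4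

lemma integral_comp_cos_eq (hc : |c| < 1) (g : ℝ → ℂ) :
    (IntegrableOn (fun θ => g (Real.cos θ)) (Set.Ioo 0 π) ↔
      IntegrableOn (fun w => (√(1 - c ^ 2) / (1 - c * Real.cos w)) • g (mobiusCos c w))
        (Set.Ioo 0 π)) ∧
    ∫ θ in Set.Ioo 0 π, g (Real.cos θ) =
      ∫ w in Set.Ioo 0 π, (√(1 - c ^ 2) / (1 - c * Real.cos w)) • g (mobiusCos c w) := by
  have hd := fun w hw => (hasDerivAt_arccos_mobiusCos hc (w := w) hw).hasDerivWithinAt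
    (s := Set.Ioo 0 π)
  have hcongr : Set.EqOn (fun w => |√(1 - c ^ 2) / (1 - c * Real.cos w)| •
      g (Real.cos (Real.arccos (mobiusCos c w))))
      (fun w => (√(1 - c ^ 2) / (1 - c * Real.cos w)) • g (mobiusCos c w)) (Set.Ioo 0 π) := by
    intro w hw
    have h3 := one_sub_mul_cos_pos hc w
    have h5 := abs_lt.1 (abs_mobiusCos_lt_one hc hw)
    simp only
    rw [Real.cos_arccos h5.1.le h5.2.le, abs_of_nonneg (by positivity)]
  constructor
  · conv_lhs => rw [← image_arccos_mobiusCos hc]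
    rw [integrableOn_image_iff_integrableOn_abs_deriv_smul measurableSet_Ioo hd
      (injOn_arccos_mobiusCos hc)]
    exact integrableOn_congr_fun hcongr measurableSet_Ioo
  · conv_lhs => rw [← image_arccos_mobiusCos hc]
    rw [integral_image_eq_integral_abs_deriv_smul measurableSet_Ioo hd
      (injOn_arccos_mobiusCos hc)]
    exact setIntegral_congr_fun measurableSet_Ioo hcongr

end Anomaly

lemma cpow0_of_pos {t : ℝ} (ht : 0 < t) (s : ℂ) : cpow0 t s = (t : ℂ) ^ s := by
  rw [cpow0, if_neg ht.ne', Complex.cpow_def_of_ne_zero (by exact_mod_cast ht.ne'),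
    Complex.ofReal_log ht.le, mul_comm]

lemma cpow0_mul {x y : ℝ} (hx : 0 < x) (hy : 0 ≤ y) (s : ℂ) :
    cpow0 (x * y) s = (x : ℂ) ^ s * cpow0 y s := by
  rcases hy.eq_or_lt with rfl | hy
  · simp [cpow0]
  · rw [cpow0_of_pos (mul_pos hx hy), cpow0_of_pos hy, Complex.ofReal_mul,
      Complex.mul_cpow_ofReal_nonneg hx.le hy.le]

lemma cpow0_mobiusCos {c : ℝ} (hc : |c| < 1) (s : ℂ) (w : ℝ) :
    (√(1 - c ^ 2) / (1 - c * Real.cos w)) • cpow0 |2 * c + 2 * mobiusCos c w| s =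
      (2 : ℂ) ^ s * (1 - (c : ℂ) ^ 2) ^ (1 / 2 + s) *
        (cpow0 |Real.cos w| s * (1 - (c : ℂ) * (Real.cos w : ℂ)) ^ (-(s + 1))) := by
  have h2 := one_sub_sq_pos_of_abs_lt_one hc
  have h3 := one_sub_mul_cos_pos hc w
  have e1 : |2 * c + 2 * mobiusCos c w| =
      (2 * ((1 - c ^ 2) * (1 - c * Real.cos w)⁻¹)) * |Real.cos w| := by
    have : 2 * c + 2 * mobiusCos c w =
        (2 * ((1 - c ^ 2) * (1 - c * Real.cos w)⁻¹)) * Real.cos w := by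
      rw [mobiusCos]
      field_simp
      ring
    rw [this, abs_mul, abs_of_pos (by positivity)]
  have h2' : ((1 - c ^ 2 : ℝ) : ℂ) ≠ 0 := by exact_mod_cast h2.ne'
  have h3' : ((1 - c * Real.cos w : ℝ) : ℂ) ≠ 0 := by exact_mod_cast h3.ne'
  have e2 : (1 - (c : ℂ) ^ 2) = ((1 - c ^ 2 : ℝ) : ℂ) := by push_cast; rfl
  have e3 : (1 - (c : ℂ) * (Real.cos w : ℂ)) = ((1 - c * Real.cos w : ℝ) : ℂ) := by
    push_cast; rfl
  have e4 : ((√(1 - c ^ 2) : ℝ) : ℂ) = ((1 - c ^ 2 : ℝ) : ℂ) ^ (1 / 2 : ℂ) := by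
    rw [Real.sqrt_eq_rpow, Complex.ofReal_cpow h2.le]
    push_cast; rfl
  have e5 : (((1 - c * Real.cos w)⁻¹ : ℝ) : ℂ) ^ s = ((1 - c * Real.cos w : ℝ) : ℂ) ^ (-s) := by
    rw [Complex.ofReal_inv, Complex.inv_cpow, Complex.cpow_neg]
    rw [Complex.arg_ofReal_of_nonneg h3.le]
    exact pi_pos.ne
  rw [e1, cpow0_mul (by positivity) (abs_nonneg _), Complex.ofReal_mul,
    Complex.mul_cpow_ofReal_nonneg two_pos.le (by positivity), Complex.ofReal_mul,
    Complex.mul_cpow_ofReal_nonneg h2.le (by positivity), e2, e3, Complex.cpow_add _ _ h2', ← e4, e5,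
    neg_add, Complex.cpow_add _ _ h3', Complex.cpow_neg_one, Complex.real_smul, Complex.ofReal_div,
    Complex.ofReal_ofNat]
  ring

lemma betaIntegral_half_succ {u : ℂ} (hu : 0 < u.re) :
    (u + 1 / 2) * Complex.betaIntegral (u + 1) (1 / 2) = u * Complex.betaIntegral u (1 / 2) := by
  have hv : (0 : ℝ) < (1 / 2 : ℂ).re := by norm_num
  have hu1 : 0 < (u + 1).re := by simp; linarith
  have hu2 : 0 < (u + 1 / 2).re := by simp; linarith
  have h0 := add_natCast_ne_zero_of_re_pos hu 0
  have h1 := add_natCast_ne_zero_of_re_pos hu2 0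
  simp only [Nat.cast_zero, add_zero] at h0 h1
  rw [Complex.betaIntegral_eq_Gamma_mul_div _ _ hu1 hv, Complex.betaIntegral_eq_Gamma_mul_div _ _ hu hv,
    Complex.Gamma_add_one _ h0, show u + 1 + 1 / 2 = u + 1 / 2 + 1 by ring, Complex.Gamma_add_one _ h1]
  have := Complex.Gamma_ne_zero_of_re_pos hu2
  generalize Complex.Gamma (u + 1 / 2) = G at *
  generalize u + 1 / 2 = v at *
  field_simp

lemma betaIntegral_half_ne_zero {u : ℂ} (hu : 0 < u.re) :
    Complex.betaIntegral u (1 / 2) ≠ 0 := by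
  have hv : (0 : ℝ) < (1 / 2 : ℂ).re := by norm_num
  have hu2 : 0 < (u + 1 / 2).re := by simp; linarith
  rw [Complex.betaIntegral_eq_Gamma_mul_div _ _ hu hv]
  exact div_ne_zero (mul_ne_zero (Complex.Gamma_ne_zero_of_re_pos hu)
    (Complex.Gamma_ne_zero_of_re_pos hv)) (Complex.Gamma_ne_zero_of_re_pos hu2)

lemma half_add_natCast_ne_zero (n : ℕ) : (1 / 2 : ℂ) + n ≠ 0 :=
  add_natCast_ne_zero_of_re_pos (by norm_num) n

lemma poch_mul_betaIntegral {u : ℂ} (hu : 0 < u.re) (m : ℕ) :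
    poch (2 * u) (2 * m) / ((2 * m).factorial : ℂ) * Complex.betaIntegral (u + m) (1 / 2) =
      Complex.betaIntegral u (1 / 2) * hypCoeff u u (1 / 2) m := by
  have hB := betaIntegral_half_ne_zero hu
  rw [← eq_hypCoeff_of_recurrence half_add_natCast_ne_zero (a := u) (b := u)
    (u := fun m : ℕ => poch (2 * u) (2 * m) / ((2 * m).factorial : ℂ) *
      Complex.betaIntegral (u + m) (1 / 2) / Complex.betaIntegral u (1 / 2)) ?_ ?_]
  · field_simp
  · simp [poch_zero]
    simpa using hB
  · intro n
    have hun : 0 < (u + n).re := by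
      have : (0 : ℝ) ≤ n := n.cast_nonneg
      simp; linarith
    have h := betaIntegral_half_succ hun
    have h1 : u + n + 1 / 2 ≠ 0 := by
      simpa using add_natCast_ne_zero_of_re_pos (x := u + n + 1 / 2) (by simp at hun ⊢; linarith) 0
    have h3 : ((2 * n).factorial : ℂ) ≠ 0 := by exact_mod_cast (2 * n).factorial_ne_zero
    have h4 : (n : ℂ) + 1 ≠ 0 := by exact_mod_cast n.succ_ne_zero
    have h5 : 2 * (n : ℂ) + 1 ≠ 0 := by exact_mod_cast (2 * n).succ_ne_zero
    have h6 := half_add_natCast_ne_zero n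
    have h7 : Complex.betaIntegral (u + ((n + 1 : ℕ) : ℂ)) (1 / 2) =
        (u + n) * Complex.betaIntegral (u + n) (1 / 2) / (u + n + 1 / 2) := by
      rw [eq_div_iff h1, ← h, mul_comm]
      push_cast
      ring_nf
    simp only [h7]
    rw [show 2 * (n + 1) = 2 * n + 1 + 1 by ring, poch_succ, poch_succ, Nat.factorial_succ,
      Nat.factorial_succ]
    push_cast
    rw [show 2 * (n : ℂ) + 1 + 1 = 2 * (n + 1) by ring,
      show 2 * u + (2 * (n : ℂ) + 1) = 2 * (u + n + 1 / 2) by ring]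
    generalize Complex.betaIntegral (u + n) (1 / 2) = B
    generalize u + n + 1 / 2 = d at h1 ⊢
    rw [show (1 / 2 : ℂ) + n = (2 * n + 1) / 2 by ring]
    generalize 2 * (n : ℂ) + 1 = e at h5 ⊢
    field_simp

lemma integral_cos_series {c : ℝ} (hc : |c| < 1) {s : ℂ} (hs : -1 < s.re) :
    ∫ w in Set.Ioo 0 (π / 2), (Real.cos w : ℂ) ^ s *
      ((1 - (c : ℂ) * (Real.cos w : ℂ)) ^ (-(s + 1)) +
        (1 + (c : ℂ) * (Real.cos w : ℂ)) ^ (-(s + 1))) =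
      Complex.betaIntegral ((1 + s) / 2) (1 / 2) *
        ∑' m, hypCoeff ((1 + s) / 2) ((1 + s) / 2) (1 / 2) m * ((c : ℂ) ^ 2) ^ m := by
  set u : ℂ := (1 + s) / 2 with hu_def
  have hu : 0 < u.re := by
    rw [hu_def, Complex.div_ofNat_re]
    simp
    linarith
  have h2u : 2 * u = s + 1 := by rw [hu_def]; ring
  have hcc : ‖(c : ℂ)‖ < 1 := by simpa using hc
  let A : ℕ → ℂ := fun m => 2 * (poch (s + 1) (2 * m) / ((2 * m).factorial : ℂ) * (c : ℂ) ^ (2 * m))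
  let F : ℕ → ℝ → ℂ := fun m w => (Real.cos w : ℂ) ^ s * (A m * (Real.cos w : ℂ) ^ (2 * m))
  have hA : Summable fun m => ‖A m‖ := by
    have h := (hasSum_poch_mul_pow (s + 1) hcc).2
    have hinj : Function.Injective fun m : ℕ => 2 * m := fun i j hij => by simpa using hij
    refine ((h.comp_injective hinj).mul_left 2).congr fun m => ?_
    simp [A]
  have hcos := (integral_cos_cpow hu).1
  rw [h2u, add_sub_cancel_right] at hcos
  have key : HasSum (fun m => ∫ w in Set.Ioo 0 (π / 2), F m w)
      (∫ w in Set.Ioo 0 (π / 2), (Real.cos w : ℂ) ^ s *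
      ((1 - (c : ℂ) * (Real.cos w : ℂ)) ^ (-(s + 1)) +
        (1 + (c : ℂ) * (Real.cos w : ℂ)) ^ (-(s + 1)))) := by
    refine hasSum_integral_of_dominated_convergence
      (fun m w => ‖(Real.cos w : ℂ) ^ s‖ * ‖A m‖) ?_ ?_ ?_ ?_ ?_
    · intro m
      exact hcos.aestronglyMeasurable.mul (Continuous.aestronglyMeasurable (by fun_prop))
    · intro m
      refine ae_of_all _ fun w => ?_
      rw [norm_mul, norm_mul, norm_pow]
      have : ‖(Real.cos w : ℂ)‖ ≤ 1 := by
          rw [Complex.norm_real]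
          exact Real.abs_cos_le_one w
      gcongr
      exact mul_le_of_le_one_right (norm_nonneg _) (pow_le_one₀ (norm_nonneg _) this)
    · exact ae_of_all _ fun w => hA.mul_left _
    · simp only [tsum_mul_left]
      exact hcos.norm.mul_const _
    · refine ae_of_all _ fun w => ?_
      have hy : ‖(c : ℂ) * (Real.cos w : ℂ)‖ < 1 := by
        rw [norm_mul]
        have : ‖(Real.cos w : ℂ)‖ ≤ 1 := by
          rw [Complex.norm_real]
          exact Real.abs_cos_le_one w
        exact (mul_le_of_le_one_right (norm_nonneg _) this).trans_lt hcc
      have hF : (fun m => F m w) = fun m => (Real.cos w : ℂ) ^ s *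
          (2 * (poch (s + 1) (2 * m) / ((2 * m).factorial : ℂ) *
            ((c : ℂ) * (Real.cos w : ℂ)) ^ (2 * m))) := by
        funext m
        simp only [F, A, mul_pow]
        ring
      rw [hF]
      exact (hasSum_even_poch_mul_pow (s + 1) hy).mul_left _
  rw [← key.tsum_eq, ← tsum_mul_left]
  refine tsum_congr fun m => ?_
  have hum : 0 < (u + m).re := by
    have : (0 : ℝ) ≤ m := m.cast_nonneg
    simp; linarith
  have h1 := (integral_cos_cpow hum).2
  have h2 := poch_mul_betaIntegral hu m
  rw [h2u] at h2
  have h3 : ∫ w in Set.Ioo 0 (π / 2), F m w =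
      A m * ∫ w in Set.Ioo 0 (π / 2), (Real.cos w : ℂ) ^ (2 * (u + m) - 1) := by
    rw [← integral_const_mul]
    refine setIntegral_congr_fun measurableSet_Ioo fun w hw => ?_
    have hcp := Real.cos_pos_of_mem_Ioo (x := w) ⟨by linarith [pi_pos, hw.1], hw.2⟩
    have hcp' : (Real.cos w : ℂ) ≠ 0 := by exact_mod_cast hcp.ne'
    simp only [F]
    rw [show 2 * (u + m) - 1 = s + ((2 * m : ℕ) : ℂ) by push_cast; linear_combination h2u,
      Complex.cpow_add _ _ hcp', Complex.cpow_natCast]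
    ring
  rw [h3, ← mul_assoc, ← h2, ← h1, ← pow_mul]
  simp only [A]
  ring

lemma continuous_one_add_mul_cos_cpow {c : ℝ} (hc : |c| < 1) (a : ℂ) :
    Continuous fun w : ℝ => (1 + (c : ℂ) * (Real.cos w : ℂ)) ^ a := by
  refine Continuous.cpow (by fun_prop) continuous_const fun w => ?_
  have h := one_sub_mul_cos_pos (c := -c) (by simpa using hc) w
  have e : (1 + (c : ℂ) * (Real.cos w : ℂ)) = ((1 - (-c) * Real.cos w : ℝ) : ℂ) := by
    push_cast; ring
  rw [e]
  exact Complex.ofReal_mem_slitPlane.2 h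

lemma integrableOn_cpow0_abs_cos_mul {c : ℝ} (hc : |c| < 1) {s : ℂ} (hs : -1 < s.re) :
    IntegrableOn (fun w : ℝ => cpow0 |Real.cos w| s *
      (1 + (c : ℂ) * (Real.cos w : ℂ)) ^ (-(s + 1))) (Set.Ioo 0 (π / 2)) := by
  have hu : 0 < ((1 + s) / 2).re := by
    rw [Complex.div_ofNat_re]
    simp
    linarith
  have hcos := (integral_cos_cpow hu).1
  rw [show 2 * ((1 + s) / 2) - 1 = s by ring] at hcos
  refine IntegrableOn.mul_continuousOn_of_subset (K := Set.Icc 0 (π / 2)) ?_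
    (continuous_one_add_mul_cos_cpow hc _).continuousOn measurableSet_Ioo isCompact_Icc
    Set.Ioo_subset_Icc_self
  refine hcos.congr_fun (fun w hw => ?_) measurableSet_Ioo
  have hcp := Real.cos_pos_of_mem_Ioo (x := w) ⟨by linarith [pi_pos, hw.1], hw.2⟩
  rw [abs_of_pos hcp, cpow0_of_pos hcp]

lemma integral_cpow0_abs_cos_mul {c : ℝ} (hc : |c| < 1) {s : ℂ} (hs : -1 < s.re) :
    IntegrableOn (fun w : ℝ => cpow0 |Real.cos w| s *
        (1 - (c : ℂ) * (Real.cos w : ℂ)) ^ (-(s + 1))) (Set.Ioo 0 π) ∧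
      ∫ w in Set.Ioo 0 π, cpow0 |Real.cos w| s * (1 - (c : ℂ) * (Real.cos w : ℂ)) ^ (-(s + 1)) =
        Complex.betaIntegral ((1 + s) / 2) (1 / 2) *
          ∑' m, hypCoeff ((1 + s) / 2) ((1 + s) / 2) (1 / 2) m * ((c : ℂ) ^ 2) ^ m := by
  have h1 := integrableOn_cpow0_abs_cos_mul (c := -c) (by simpa using hc) hs
  have h2 := integrableOn_cpow0_abs_cos_mul hc hs
  simp only [Complex.ofReal_neg, neg_mul, ← sub_eq_add_neg] at h1
  have hpi : 2 * (π / 2) = π := by ring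
  have hrefl : ∀ w : ℝ, cpow0 |Real.cos (2 * (π / 2) - w)| s *
      (1 - (c : ℂ) * (Real.cos (2 * (π / 2) - w) : ℂ)) ^ (-(s + 1)) =
      cpow0 |Real.cos w| s * (1 + (c : ℂ) * (Real.cos w : ℂ)) ^ (-(s + 1)) := fun w => by
    rw [hpi, Real.cos_pi_sub, abs_neg, Complex.ofReal_neg, mul_neg, sub_neg_eq_add]
  have h3 := integral_Ioo_two_mul (f := fun w : ℝ => cpow0 |Real.cos w| s *
    (1 - (c : ℂ) * (Real.cos w : ℂ)) ^ (-(s + 1))) (by positivity : 0 < π / 2) h1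
    (by simpa only [hrefl] using h2)
  simp only [hrefl] at h3
  rw [hpi] at h3
  refine ⟨h3.1, h3.2.trans ?_⟩
  rw [← integral_cos_series hc hs]
  refine setIntegral_congr_fun measurableSet_Ioo fun w hw => ?_
  have hcp := Real.cos_pos_of_mem_Ioo (x := w) ⟨by linarith [pi_pos, hw.1], hw.2⟩
  rw [abs_of_pos hcp, cpow0_of_pos hcp, mul_add]

lemma integral_cpow0_abs_add_cos {c : ℝ} (hc : |c| < 1) {s : ℂ} (hs : -1 < s.re) :
    IntegrableOn (fun θ : ℝ => cpow0 |2 * c + 2 * Real.cos θ| s) (Set.Ioo 0 π) ∧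
      ∫ θ in Set.Ioo 0 π, cpow0 |2 * c + 2 * Real.cos θ| s =
        (2 : ℂ) ^ s * (1 - (c : ℂ) ^ 2) ^ (1 / 2 + s) *
          (Complex.betaIntegral ((1 + s) / 2) (1 / 2) *
            ∑' m, hypCoeff ((1 + s) / 2) ((1 + s) / 2) (1 / 2) m * ((c : ℂ) ^ 2) ^ m) := by
  obtain ⟨h1, h2⟩ := integral_comp_cos_eq hc (fun x => cpow0 |2 * c + 2 * x| s)
  obtain ⟨h3, h4⟩ := integral_cpow0_abs_cos_mul hc hs
  simp only [cpow0_mobiusCos hc] at h1 h2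
  refine ⟨h1.2 (h3.const_mul _), ?_⟩
  rw [h2, integral_const_mul, h4]

lemma W1_two_mul {c : ℝ} (hc : |c| < 1) {s : ℂ} (hs : -1 < s.re) :
    W1 (2 * c) s = (π : ℂ)⁻¹ * ((2 : ℂ) ^ s * (1 - (c : ℂ) ^ 2) ^ (1 / 2 + s) *
      (Complex.betaIntegral ((1 + s) / 2) (1 / 2) *
        ∑' m, hypCoeff ((1 + s) / 2) ((1 + s) / 2) (1 / 2) m * ((c : ℂ) ^ 2) ^ m)) := by
  obtain ⟨h1, h2⟩ := integral_cpow0_abs_add_cos hc hs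
  have hrefl : ∀ θ : ℝ, cpow0 |2 * c + 2 * Real.cos (2 * π - θ)| s =
      cpow0 |2 * c + 2 * Real.cos θ| s := fun θ => by rw [Real.cos_two_pi_sub]
  have h3 := (integral_Ioo_two_mul pi_pos h1 (by simpa only [hrefl] using h1)).2
  simp only [hrefl] at h3
  rw [W1, intervalIntegral.integral_of_le two_pi_pos.le, integral_Ioc_eq_integral_Ioo, h3,
    integral_add h1 h1, h2]
  have : (π : ℂ) ≠ 0 := by exact_mod_cast pi_ne_zero
  push_cast
  field_simp
  ring

lemma two_cpow_mul_betaIntegral {s : ℂ} (hs : -1 < s.re) :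
    (π : ℂ)⁻¹ * ((2 : ℂ) ^ s * Complex.betaIntegral ((1 + s) / 2) (1 / 2)) =
      (4 : ℂ) ^ s * Complex.Gamma ((1 + s) / 2) ^ 2 / ((π : ℂ) * Complex.Gamma (1 + s)) := by
  have hu : 0 < ((1 + s) / 2).re := by
    rw [Complex.div_ofNat_re]
    simp
    linarith
  have hu2 : 0 < ((1 + s) / 2 + 1 / 2).re := by
    rw [Complex.add_re]
    norm_num
    linarith
  have hs1 : 0 < (1 + s).re := by
    simp
    linarith
  have hG1 := Complex.Gamma_ne_zero_of_re_pos hu2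
  have hG2 := Complex.Gamma_ne_zero_of_re_pos hs1
  have hpi : (π : ℂ) ≠ 0 := by exact_mod_cast pi_ne_zero
  have h2s : (2 : ℂ) ^ s ≠ 0 := by simp [Complex.cpow_eq_zero_iff]
  have hdup := Complex.Gamma_mul_Gamma_add_half ((1 + s) / 2)
  rw [show 2 * ((1 + s) / 2) = 1 + s by ring, show 1 - (1 + s) = -s by ring, Complex.cpow_neg] at hdup
  have h4 : (4 : ℂ) ^ s = 2 ^ s * 2 ^ s := by
    have := Complex.natCast_mul_natCast_cpow 2 2 s
    norm_num at this
    exact this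
  have hhalf : Complex.Gamma (1 / 2) = (√π : ℂ) := by
    rw [Complex.Gamma_one_half_eq, Real.sqrt_eq_rpow, Complex.ofReal_cpow pi_pos.le]
    norm_num
  rw [Complex.betaIntegral_eq_Gamma_mul_div _ _ hu (by norm_num), h4, hhalf]
  generalize Complex.Gamma ((1 + s) / 2 + 1 / 2) = G at *
  generalize Complex.Gamma ((1 + s) / 2) = H at *
  generalize Complex.Gamma (1 + s) = K at *
  field_simp at hdup ⊢
  linear_combination (-H) * hdup

/-- For `|k| < 2` and `Re(s) > −1`,
`W₁(k;s) = (4^s Γ((1+s)/2)² / (π Γ(1+s))) · ₂F₁(−s/2, −s/2; 1/2; k²/4)`. -/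
theorem stmt2 (k : ℝ) (hk : |k| < 2) (s : ℂ) (hs : -1 < s.re) :
    W1 k s = (4 : ℂ) ^ s * Complex.Gamma ((1 + s)/2) ^ 2 /
        ((Real.pi : ℂ) * Complex.Gamma (1 + s)) *
      ∑' n : ℕ, poch (-s / 2) n * poch (-s / 2) n /
        (poch (1/2) n * (n.factorial : ℂ)) * ((k : ℂ) ^ 2 / 4) ^ n := by
  obtain ⟨c, rfl⟩ : ∃ c, k = 2 * c := ⟨k / 2, by ring⟩
  have hc : |c| < 1 := by
    rw [abs_mul, abs_two] at hk
    linarith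
  have hu : 0 < ((1 + s) / 2).re := by
    rw [Complex.div_ofNat_re]
    simp
    linarith
  have e : (1 : ℂ) / 2 - -s / 2 = (1 + s) / 2 := by ring
  have hne : ∀ n : ℕ, (1 : ℂ) / 2 - -s / 2 + n ≠ 0 := fun n => by
    rw [e]
    exact add_natCast_ne_zero_of_re_pos hu n
  have hz : ‖(c : ℂ) ^ 2‖ < 1 := by
    rw [norm_pow, Complex.norm_real, Real.norm_eq_abs]
    exact pow_lt_one₀ (abs_nonneg c) hc two_ne_zero
  have heuler := tsum_hypCoeff_euler hne hne half_add_natCast_ne_zero hz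
  rw [e, show (1 + s) / 2 - -s / 2 = 1 / 2 + s by ring] at heuler
  simp only [hypCoeff] at heuler
  rw [W1_two_mul hc hs, ← two_cpow_mul_betaIntegral hs]
  simp only [hypCoeff]
  rw [show (((2 * c : ℝ) : ℂ) ^ 2 / 4) = (c : ℂ) ^ 2 by push_cast; ring, heuler]
  ring
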